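/- |𝓟(n)| = (1+o(1))·2^{n(n+1)/2}; that is, |𝓟(n)|/2^{n(n+1)/2} → 1 as n → ∞. -/

import Mathlib

open Filter

noncomputable section

/-- The type of `2n` literals: `(i, false)` is `xᵢ` and `(i, true)` is `x̄ᵢ`. -/
abbrev Lit (n : ℕ) := Fin n × Bool

/-- Negation of a literal. -/
def Lit.bar {n : ℕ} (u : Lit n) : Lit n := (u.1, !u.2)

/-- `𝓟(n)`: partial orders on the `2n` literals in which `xᵢ` and `x̄ᵢ` are
incomparable for every `i`, and `u ≤ v` iff `v̄ ≤ ū`. -/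
def LitPoset (n : ℕ) : Type :=
  {r : Lit n → Lit n → Prop //
    IsPartialOrder (Lit n) r ∧ (∀ (i : Fin n) (b : Bool), ¬ r (i, b) (i, !b)) ∧
    ∀ u v : Lit n, r u v ↔ r v.bar u.bar}

open Classical in
/-- Clause graphs: `E u v` means that `ū < v` in the poset. -/
structure ClauseG (n : ℕ) where
  E : Lit n → Lit n → Prop
  symm : ∀ u v, E u v → E v u
  ne : ∀ u v, E u v → u.1 ≠ v.1
  uniq : ∀ u v u' v', E u v → E u' v' → u.1 = u'.1 → v.1 = v'.1 → u = u' ∧ v = v'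
  trans : ∀ u v w, E u v → E v.bar w → E u w

@[simp] lemma Lit.bar_bar {n : ℕ} (u : Lit n) : u.bar.bar = u := by
  simp [Lit.bar]

@[simp] lemma Lit.bar_fst {n : ℕ} (u : Lit n) : u.bar.1 = u.1 := rfl

lemma Lit.bar_ne {n : ℕ} (u : Lit n) : u.bar ≠ u := by
  obtain ⟨i, b⟩ := u
  cases b <;> simp [Lit.bar]

lemma Lit.eq_or_eq_bar {n : ℕ} {u v : Lit n} (h : u.1 = v.1) : v = u ∨ v = u.bar := by
  obtain ⟨i, b⟩ := u
  obtain ⟨j, c⟩ := v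
  simp only at h
  subst h
  cases b <;> cases c <;> simp [Lit.bar]

theorem ClauseG.ext' {n : ℕ} {G H : ClauseG n} (h : ∀ u v, G.E u v ↔ H.E u v) : G = H := by
  cases G; cases H
  congr
  funext u v
  exact propext (h u v)

def toClause {n : ℕ} (p : LitPoset n) : ClauseG n where
  E u v := p.1 u.bar v ∧ v ≠ u.bar
  symm := by
    obtain ⟨r, hp, hi, hd⟩ := p
    rintro u v ⟨h1, h2⟩
    refine ⟨?_, ?_⟩
    · have := (hd _ _).1 h1
      simpa using this
    · rintro rfl
      simp at h2
  ne := by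
    obtain ⟨r, hp, hi, hd⟩ := p
    rintro u v ⟨h1, h2⟩ h
    rcases Lit.eq_or_eq_bar h with rfl | rfl
    · have := hi v.1 (!v.2)
      simp [Lit.bar] at this h1
      exact this h1
    · exact h2 rfl
  uniq := by
    obtain ⟨r, hp, hi, hd⟩ := p
    rintro u v u' v' ⟨h1, h2⟩ ⟨h3, h4⟩ h5 h6
    have hi' : ∀ w : Lit n, ¬ r w w.bar := fun w => hi w.1 w.2
    simp only at h1 h3
    rcases Lit.eq_or_eq_bar h5 with rfl | rfl <;> rcases Lit.eq_or_eq_bar h6 with rfl | rfl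
    · exact ⟨rfl, rfl⟩
    · exfalso
      have h7 := (hd _ _).1 h3
      simp only [Lit.bar_bar] at h7
      have := hp.trans _ _ _ h1 h7
      have h8 := hi' u'.bar
      simp only [Lit.bar_bar] at h8
      exact h8 this
    · exfalso
      simp only [Lit.bar_bar] at h3
      have h7 := (hd _ _).1 h1
      simp only [Lit.bar_bar] at h7
      have := hp.trans _ _ _ h7 h3
      have h8 := hi' v'.bar
      simp only [Lit.bar_bar] at h8
      exact h8 this
    · exfalso
      simp only [Lit.bar_bar] at h3
      have h7 := (hd _ _).1 h3
      simp only [Lit.bar_bar] at h7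
      exact h2 (hp.antisymm _ _ h7 h1)
  trans := by
    obtain ⟨r, hp, hi, hd⟩ := p
    rintro u v w ⟨h1, h2⟩ ⟨h3, h4⟩
    simp only [Lit.bar_bar] at h1 h2 h3 h4 ⊢
    refine ⟨hp.trans _ _ _ h1 h3, ?_⟩
    rintro rfl
    exact h2 (hp.antisymm _ _ h3 h1)

def ofClause {n : ℕ} (G : ClauseG n) : LitPoset n :=
  ⟨fun u v => u = v ∨ G.E u.bar v, by
    refine ⟨?_, ?_, ?_⟩
    · refine { refl := fun a => Or.inl rfl, trans := ?_, antisymm := ?_ }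
      · rintro a b c (rfl | h1) (rfl | h2)
        · exact Or.inl rfl
        · exact Or.inr h2
        · exact Or.inr h1
        · exact Or.inr (G.trans _ _ _ h1 h2)
      · rintro a b (rfl | h1) (h | h2)
        · rfl
        · rfl
        · exact h.symm
        · exfalso
          have := (G.uniq _ _ _ _ h1 (G.symm _ _ h2) rfl rfl).1
          exact Lit.bar_ne _ this
    · rintro i b (h | h)
      · simp at h
      · exact G.ne _ _ h rfl
    · intro u v
      simp only [Lit.bar_bar]
      constructor
      · rintro (rfl | h)
        · exact Or.inl rfl
        · exact Or.inr (G.symm _ _ h)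
      · rintro (h | h)
        · left
          have := congrArg Lit.bar h
          simpa using this.symm
        · exact Or.inr (G.symm _ _ h)⟩

def litEquiv (n : ℕ) : LitPoset n ≃ ClauseG n where
  toFun := toClause
  invFun := ofClause
  left_inv := by
    intro p
    apply Subtype.ext
    funext u v
    simp only [ofClause, toClause, Lit.bar_bar]
    apply propext
    have hr := p.2.1.refl
    constructor
    · rintro (rfl | h)
      · exact hr _
      · exact h.1
    · intro h
      by_cases huv : u = v
      · exact Or.inl huv
      · exact Or.inr ⟨h, Ne.symm huv⟩
  right_inv := by
    intro G
    apply ClauseG.ext'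
    intro u v
    simp only [ofClause, toClause, Lit.bar_bar]
    constructor
    · rintro ⟨h1 | h1, h2⟩
      · exact absurd h1.symm h2
      · exact h1
    · intro h
      refine ⟨Or.inr h, ?_⟩
      rintro rfl
      exact G.ne _ _ h rfl

instance (n : ℕ) : Finite (ClauseG n) := by
  apply Finite.of_injective (fun G : ClauseG n => G.E)
  intro G H h
  apply ClauseG.ext'
  intro u v
  have := congrFun (congrFun h u) v
  simp only at this
  rw [this]

instance (n : ℕ) : Fintype (ClauseG n) := Fintype.ofFinite _

/-- neighbourhood -/
def Nb {n : ℕ} (G : ClauseG n) (u : Lit n) : Finset (Lit n) :=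
  open Classical in Finset.univ.filter (fun v => G.E u v)

lemma mem_Nb {n : ℕ} {G : ClauseG n} {u v : Lit n} : v ∈ Nb G u ↔ G.E u v := by
  classical
  simp [Nb]

/-- generated set -/
def Cl {n : ℕ} (G : ClauseG n) (W : Finset (Lit n)) : Finset (Lit n) :=
  W ∪ W.biUnion (fun w => Nb G w.bar)

def vars {n : ℕ} (C : Finset (Lit n)) : Finset (Fin n) := C.image Prod.fst

lemma mem_vars {n : ℕ} {C : Finset (Lit n)} {y : Fin n} : y ∈ vars C ↔ ∃ c, (y, c) ∈ C := by
  simp [vars]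

/-- delete all edges at variable `a` -/
def del {n : ℕ} (a : Fin n) (G : ClauseG n) : ClauseG n where
  E u v := G.E u v ∧ u.1 ≠ a ∧ v.1 ≠ a
  symm u v h := ⟨G.symm _ _ h.1, h.2.2, h.2.1⟩
  ne u v h := G.ne _ _ h.1
  uniq u v u' v' h h' := G.uniq _ _ _ _ h.1 h'.1
  trans u v w h h' := ⟨G.trans _ _ _ h.1 h'.1, h.2.1, h'.2.2⟩

/-- the attachment of `a` -/
def att {n : ℕ} (a : Fin n) (G : ClauseG n) (y : Fin n) : Finset (Bool × Bool) :=
  open Classical in Finset.univ.filter (fun p => G.E (a, p.1) (y, p.2))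

lemma mem_att {n : ℕ} {a : Fin n} {G : ClauseG n} {y : Fin n} {p : Bool × Bool} :
    p ∈ att a G y ↔ G.E (a, p.1) (y, p.2) := by
  classical
  simp [att]

lemma del_att_inj {n : ℕ} (a : Fin n) {G H : ClauseG n} (h1 : del a G = del a H)
    (h2 : att a G = att a H) : G = H := by
  have key : ∀ u v : Lit n, u.1 = a → (G.E u v ↔ H.E u v) := by
    rintro ⟨i, b⟩ ⟨j, c⟩ rfl
    have := congrFun h2 j
    have h3 : (b, c) ∈ att i G j ↔ (b, c) ∈ att i H j := by rw [this]
    simpa [mem_att] using h3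
  apply ClauseG.ext'
  intro u v
  by_cases hu : u.1 = a
  · exact key u v hu
  · by_cases hv : v.1 = a
    · exact ⟨fun h => H.symm _ _ ((key v u hv).1 (G.symm _ _ h)),
        fun h => G.symm _ _ ((key v u hv).2 (H.symm _ _ h))⟩
    · have : (del a G).E u v ↔ (del a H).E u v := by rw [h1]
      simpa [del, hu, hv] using this

def Iso {n : ℕ} (a : Fin n) (G : ClauseG n) : Prop := ∀ u v, G.E u v → u.1 ≠ a

lemma iso_del {n : ℕ} (a : Fin n) (G : ClauseG n) : Iso a (del a G) := fun _ _ h => h.2.1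

def emb {n : ℕ} (a : Fin (n + 1)) (u : Lit n) : Lit (n + 1) := (a.succAbove u.1, u.2)

def restr {n : ℕ} (a : Fin (n + 1)) (G : ClauseG (n + 1)) : ClauseG n where
  E u v := G.E (emb a u) (emb a v)
  symm u v h := G.symm _ _ h
  ne u v h := by
    intro h'
    exact G.ne _ _ h (by simp [emb, h'])
  uniq u v u' v' h h' e e' := by
    have := G.uniq _ _ _ _ h h' (by simp [emb, e]) (by simp [emb, e'])
    simpa [emb, Prod.ext_iff] using this
  trans u v w h h' := G.trans _ _ _ h h'

open Classical in
lemma card_iso_le {n : ℕ} (a : Fin (n + 1)) :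
    (Finset.univ.filter (fun G : ClauseG (n + 1) => Iso a G)).card ≤ Fintype.card (ClauseG n) := by
  rw [← Finset.card_univ]
  apply Finset.card_le_card_of_injOn (restr a)
  · intro x _
    simp
  · intro G hG H hH h
    simp only [Finset.coe_filter, Finset.mem_univ, true_and, Set.mem_ofPred_eq] at hG hH
    apply ClauseG.ext'
    intro u v
    by_cases hu : u.1 = a
    · exact ⟨fun h => absurd hu (hG _ _ h), fun h => absurd hu (hH _ _ h)⟩
    by_cases hv : v.1 = a
    · exact ⟨fun h => absurd hv (hG _ _ (G.symm _ _ h)),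
        fun h => absurd hv (hH _ _ (H.symm _ _ h))⟩
    obtain ⟨i, hi⟩ := Fin.exists_succAbove_eq hu
    obtain ⟨j, hj⟩ := Fin.exists_succAbove_eq hv
    have h3 : (restr a G).E (i, u.2) (j, v.2) ↔ (restr a H).E (i, u.2) (j, v.2) := by rw [h]
    simpa [restr, emb, hi, hj] using h3

open Classical in
lemma count_one {n : ℕ} (a : Fin (n + 1)) (S : Finset (ClauseG (n + 1)))
    (T : ClauseG (n + 1) → Finset (Fin (n + 1) → Finset (Bool × Bool))) (M : ℝ)
    (h1 : ∀ G ∈ S, att a G ∈ T (del a G)) (h2 : ∀ G, ((T G).card : ℝ) ≤ M) :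
    (S.card : ℝ) ≤ Fintype.card (ClauseG n) * M := by
  have hM : 0 ≤ M := by
    by_cases hne : Nonempty (ClauseG (n + 1))
    · obtain ⟨G⟩ := hne
      exact le_trans (Nat.cast_nonneg _) (h2 G)
    · exfalso
      exact hne ⟨⟨fun _ _ => False, by simp, by simp, by simp, by simp⟩⟩
  have h3 : S.card ≤ ((Finset.univ.filter (fun G : ClauseG (n + 1) => Iso a G)).sigma T).card := by
    apply Finset.card_le_card_of_injOn
      (fun G => (⟨del a G, att a G⟩ : (_ : ClauseG (n + 1)) × (Fin (n + 1) → Finset (Bool × Bool))))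
    · intro G hG
      simp only [Finset.coe_sigma, Set.mem_sigma_iff, Finset.mem_coe, Finset.mem_filter,
        Finset.mem_univ, true_and]
      exact ⟨iso_del a G, h1 G hG⟩
    · intro G _ H _ h
      simp only [Sigma.mk.injEq, heq_eq_eq] at h
      exact del_att_inj a h.1 h.2
  rw [Finset.card_sigma] at h3
  calc (S.card : ℝ) ≤ ((∑ G ∈ Finset.univ.filter (fun G : ClauseG (n + 1) => Iso a G),
        (T G).card : ℕ) : ℝ) := by exact_mod_cast h3
    _ = ∑ G ∈ Finset.univ.filter (fun G : ClauseG (n + 1) => Iso a G), ((T G).card : ℝ) := by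
        push_cast; rfl
    _ ≤ ∑ G ∈ Finset.univ.filter (fun G : ClauseG (n + 1) => Iso a G), M :=
        Finset.sum_le_sum (fun G _ => h2 G)
    _ = (Finset.univ.filter (fun G : ClauseG (n + 1) => Iso a G)).card * M := by
        rw [Finset.sum_const, nsmul_eq_mul]
    _ ≤ _ := by
        apply mul_le_mul_of_nonneg_right _ hM
        exact_mod_cast card_iso_le a

open Classical in
lemma count_many {n : ℕ} {I : Type} [Fintype I] (a : I → Fin (n + 1))
    (S : Finset (ClauseG (n + 1)))
    (T : I → ClauseG (n + 1) → Finset (Fin (n + 1) → Finset (Bool × Bool))) (M : ℝ)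
    (h1 : ∀ G ∈ S, ∃ i, att (a i) G ∈ T i (del (a i) G)) (h2 : ∀ i G, ((T i G).card : ℝ) ≤ M) :
    (S.card : ℝ) ≤ Fintype.card I * (Fintype.card (ClauseG n) * M) := by
  have h3 : S ⊆ Finset.univ.biUnion
      (fun i => Finset.univ.filter (fun G => att (a i) G ∈ T i (del (a i) G))) := by
    intro G hG
    simpa using h1 G hG
  have h4 := (Finset.card_le_card h3).trans Finset.card_biUnion_le
  calc (S.card : ℝ) ≤ ((∑ i : I,
        (Finset.univ.filter (fun G => att (a i) G ∈ T i (del (a i) G))).card : ℕ) : ℝ) := by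
        exact_mod_cast h4
    _ = ∑ i : I, ((Finset.univ.filter (fun G => att (a i) G ∈ T i (del (a i) G))).card : ℝ) := by
        push_cast; rfl
    _ ≤ ∑ i : I, (Fintype.card (ClauseG n) * M) := by
        apply Finset.sum_le_sum
        intro i _
        apply count_one (a i) _ (T i) M _ (h2 i)
        intro G hG
        simpa using hG
    _ = _ := by simp

lemma mem_Cl {n : ℕ} {G : ClauseG n} {W : Finset (Lit n)} {v : Lit n} :
    v ∈ Cl G W ↔ v ∈ W ∨ ∃ w ∈ W, G.E w.bar v := by
  simp only [Cl, Finset.mem_union, Finset.mem_biUnion, mem_Nb]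

lemma Cl_del {n : ℕ} {G : ClauseG n} {W : Finset (Lit n)} {a : Fin n} (h : a ∉ vars (Cl G W)) :
    Cl (del a G) W = Cl G W := by
  rw [mem_vars] at h
  push Not at h
  have h' : ∀ v ∈ Cl G W, v.1 ≠ a := by
    rintro ⟨i, c⟩ hv rfl
    exact h c hv
  ext v
  constructor
  · rw [mem_Cl, mem_Cl]
    rintro (hv | ⟨w, hw, hE⟩)
    · exact Or.inl hv
    · exact Or.inr ⟨w, hw, hE.1⟩
  · intro hv
    have hva := h' v hv
    rw [mem_Cl] at hv ⊢
    rcases hv with hv | ⟨w, hw, hE⟩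
    · exact Or.inl hv
    · exact Or.inr ⟨w, hw, hE, h' w (mem_Cl.2 (Or.inl hw)), hva⟩

def small : Finset (Finset (Bool × Bool)) := Finset.univ.filter (fun p => p.card ≤ 1)

lemma card_small : small.card = 5 := by decide

lemma att_small {n : ℕ} (a : Fin n) (G : ClauseG n) (y : Fin n) : att a G y ∈ small := by
  simp only [small, Finset.mem_filter, Finset.mem_univ, true_and]
  rw [Finset.card_le_one]
  rintro ⟨b, c⟩ h ⟨b', c'⟩ h'
  rw [mem_att] at h h'
  have := G.uniq _ _ _ _ h h' rfl rfl
  simpa using this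

def TL {n : ℕ} (s : ℕ) (W : Finset (Lit n)) (G : ClauseG n) :
    Finset (Fin n → Finset (Bool × Bool)) :=
  if 5 * (vars (Cl G W)).card ≤ 2 * n then
    (Fintype.piFinset (fun _ => small)).filter
      (fun f => (Finset.univ.filter (fun y => y ∉ vars (Cl G W) ∧ f y ≠ ∅)).card ≤ 2 * s)
  else ∅

lemma mem_TL {n : ℕ} (s : ℕ) (W : Finset (Lit n)) (G : ClauseG n) (a : Fin n)
    (h1 : a ∉ vars (Cl G W)) (h2 : 5 * (vars (Cl G W)).card ≤ 2 * n)
    (h3 : ∀ c, (Nb G (a, c) \ Cl G W).card ≤ s) : att a G ∈ TL s W (del a G) := by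
  classical
  rw [TL, Cl_del h1, if_pos h2, Finset.mem_filter]
  refine ⟨by simp [att_small], ?_⟩
  have hsub : Finset.univ.filter (fun y => y ∉ vars (Cl G W) ∧ att a G y ≠ ∅) ⊆
      ((Nb G (a, false) \ Cl G W) ∪ (Nb G (a, true) \ Cl G W)).image Prod.fst := by
    intro y hy
    simp only [Finset.mem_filter, Finset.mem_univ, true_and] at hy
    obtain ⟨hy1, hy2⟩ := hy
    obtain ⟨⟨b, c⟩, hp⟩ := Finset.nonempty_iff_ne_empty.2 hy2
    rw [mem_att] at hp
    rw [mem_vars] at hy1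
    push Not at hy1
    rw [Finset.mem_image]
    refine ⟨(y, c), ?_, rfl⟩
    rw [Finset.mem_union, Finset.mem_sdiff, Finset.mem_sdiff, mem_Nb, mem_Nb]
    cases b
    · exact Or.inl ⟨hp, hy1 c⟩
    · exact Or.inr ⟨hp, hy1 c⟩
  have := Finset.card_le_card hsub
  have h4 := this.trans Finset.card_image_le
  have h5 := h4.trans (Finset.card_union_le _ _)
  have := h3 false
  have := h3 true
  omega

def t2 {n : ℕ} (s : ℕ) (a : Fin n) (b : Bool) (W : Finset (Lit n)) (G : ClauseG n) (y : Fin n) :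
    Finset (Finset (Bool × Bool)) :=
  if y = a then {∅} else
  if y ∈ vars (Cl G W) then (if (y, false) ∈ Cl G W then {{(b, false)}} else {{(b, true)}}) else
    {∅} ∪ (Finset.univ.filter (fun c : Bool => (Nb G (y, !c) \ Cl G W).card < s)).image
      (fun c => {(b, c)})

def Cond2 {n : ℕ} (s : ℕ) (a : Fin n) (W : Finset (Lit n)) (G : ClauseG n) : Prop :=
  2 * n < 5 * (vars (Cl G W)).card ∨ (s ≤ (vars (Cl G W)).card ∧
    ∀ y, y ∉ vars (Cl G W) → y ≠ a → ∃ c, s ≤ (Nb G (y, c) \ Cl G W).card)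

open Classical in
def T2 {n : ℕ} (s : ℕ) (a : Fin n) (b : Bool) (W : Finset (Lit n)) (G : ClauseG n) :
    Finset (Fin n → Finset (Bool × Bool)) :=
  if Cond2 s a W G then Fintype.piFinset (t2 s a b W G) else ∅

def Unate {n : ℕ} (G : ClauseG n) : Prop := ∀ y, ∃ b, ∀ v, ¬ G.E (y, b) v

lemma exists_top {n : ℕ} (G : ClauseG n) (w : Lit n) (h : (Nb G w).Nonempty) :
    ∃ a ∈ Nb G w, Nb G a.bar = ∅ := by
  obtain ⟨a, ha, hmin⟩ := Finset.exists_min_image (Nb G w) (fun a => (Nb G a.bar).card) h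
  refine ⟨a, ha, ?_⟩
  by_contra hne
  obtain ⟨a', ha'⟩ := Finset.nonempty_iff_ne_empty.2 hne
  have h1 : a' ∈ Nb G w := by
    rw [mem_Nb] at *
    exact G.trans _ _ _ ha ha'
  have h2 : Nb G a'.bar ⊂ Nb G a.bar := by
    rw [Finset.ssubset_iff_of_subset]
    · refine ⟨a', ha', ?_⟩
      rw [mem_Nb]
      intro h
      exact G.ne _ _ h rfl
    · intro z hz
      rw [mem_Nb] at *
      exact G.trans _ _ _ ha' hz
  have := Finset.card_lt_card h2
  have := hmin a' h1
  omega

lemma mem_T2 {n : ℕ} (s : ℕ) (W : Finset (Lit n)) (G : ClauseG n) (a : Lit n)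
    (h0 : Nb G a.bar = ∅) (h1 : Cl G W ⊆ Nb G a)
    (h3 : ∀ u ∈ Nb G a, (Nb G u.bar \ Cl G W).card < s)
    (hc : Cond2 s a.1 W (del a.1 G)) : att a.1 G ∈ T2 s a.1 a.2 W (del a.1 G) := by
  have ha : a.1 ∉ vars (Cl G W) := by
    rw [mem_vars]
    rintro ⟨c, hc⟩
    exact G.ne _ _ (mem_Nb.1 (h1 hc)) rfl
  have h0' : ∀ v, ¬ G.E (a.1, !a.2) v := by
    intro v hv
    have : v ∈ Nb G a.bar := mem_Nb.2 hv
    simp [h0] at this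
  have key : ∀ y p, p ∈ att a.1 G y → p.1 = a.2 ∧ G.E a (y, p.2) := by
    rintro y ⟨b, c⟩ hp
    rw [mem_att] at hp
    simp only at hp ⊢
    have : b = a.2 := by
      by_contra hne
      have : b = !a.2 := by
        cases b <;> cases h : a.2 <;> simp_all
      subst this
      exact h0' _ hp
    subst this
    exact ⟨rfl, hp⟩
  have key2 : ∀ y c, G.E a (y, c) → att a.1 G y = {(a.2, c)} := by
    intro y c h
    ext ⟨b', c'⟩
    rw [Finset.mem_singleton]
    constructor
    · intro hp
      obtain ⟨e, h'⟩ := key y _ hp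
      simp only at e h'
      have := (G.uniq _ _ _ _ h h' rfl rfl).2
      simp at this
      rw [e, this]
    · intro hp
      rw [hp, mem_att]
      exact h
  rw [T2, if_pos hc, Fintype.mem_piFinset]
  intro y
  rw [t2, Cl_del ha]
  split_ifs with e1 e2 e3
  · rw [Finset.mem_singleton, Finset.eq_empty_iff_forall_notMem]
    intro p hp
    obtain ⟨_, h'⟩ := key y _ hp
    exact G.ne _ _ h' e1.symm
  · rw [Finset.mem_singleton]
    exact key2 _ _ (mem_Nb.1 (h1 e3))
  · rw [Finset.mem_singleton]
    obtain ⟨c, hc⟩ := mem_vars.1 e2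
    have : c = true := by
      cases c
      · exact absurd hc e3
      · rfl
    subst this
    exact key2 _ _ (mem_Nb.1 (h1 hc))
  · rw [Finset.mem_union, Finset.mem_singleton]
    by_cases hy : att a.1 G y = ∅
    · exact Or.inl hy
    · right
      obtain ⟨⟨b, c⟩, hp⟩ := Finset.nonempty_iff_ne_empty.2 hy
      obtain ⟨_, h'⟩ := key y _ hp
      simp only at h'
      rw [Finset.mem_image]
      refine ⟨c, ?_, (key2 _ _ h').symm⟩
      simp only [Finset.mem_filter, Finset.mem_univ, true_and]
      refine lt_of_le_of_lt (Finset.card_le_card ?_) (h3 (y, c) (mem_Nb.2 h'))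
      apply Finset.sdiff_subset_sdiff _ (Finset.Subset.refl _)
      intro z hz
      rw [mem_Nb] at *
      exact hz.1

theorem structure_thm {n : ℕ} (G : ClauseG n) (s K : ℕ) (hs : 1 ≤ s) (hK : n < (K + 1) * s) :
    Unate G ∨ (∃ a W, W.card ≤ K ∧ att a G ∈ TL s W (del a G)) ∨
    (∃ a b W, W.card ≤ K ∧ att a G ∈ T2 s a b W (del a G)) := by
  classical
  by_cases hU : Unate G
  · exact Or.inl hU
  right
  by_cases hL : (∃ a W, W.card ≤ K ∧ att a G ∈ TL s W (del a G))
  · exact Or.inl hL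
  right
  -- negation of the low class
  have hL' : ∀ a W, W.card ≤ K → a ∉ vars (Cl G W) → 5 * (vars (Cl G W)).card ≤ 2 * n →
      ∃ c, s < (Nb G (a, c) \ Cl G W).card := by
    intro a W hW h1 h2
    by_contra hcon
    push Not at hcon
    exact hL ⟨a, W, hW, mem_TL s W G a h1 h2 hcon⟩
  have hCl0 : Cl G ∅ = ∅ := by simp [Cl]
  have hdeg : ∀ y, ∃ c, s < (Nb G (y, c)).card := by
    intro y
    have := hL' y ∅ (by simp) (by simp [hCl0, vars]) (by simp [hCl0, vars])
    simpa [hCl0] using this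
  rw [Unate] at hU
  push Not at hU
  obtain ⟨y, hy⟩ := hU
  obtain ⟨c, hc⟩ := hdeg y
  -- `w = (y, !c)`
  obtain ⟨v, hv⟩ := hy (!c)
  obtain ⟨a, haw, ha0⟩ := exists_top G (y, !c) ⟨v, mem_Nb.2 hv⟩
  set w : Lit n := (y, !c) with hw
  have hwb : w.bar = (y, c) := by simp [hw, Lit.bar]
  have hclosed : ∀ u ∈ Nb G a, Nb G u.bar ⊆ Nb G a := by
    intro u hu z hz
    rw [mem_Nb] at *
    exact G.trans _ _ _ hu hz
  have hClA : ∀ W ⊆ Nb G a, Cl G W ⊆ Nb G a := by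
    intro W hW z hz
    rcases mem_Cl.1 hz with h | ⟨u, hu, h⟩
    · exact hW h
    · exact hclosed u (hW hu) (mem_Nb.2 h)
  have hcardA : ∀ C ⊆ Nb G a, (vars C).card = C.card := by
    intro C hC
    apply Finset.card_image_of_injOn
    intro u hu v hv huv
    have hu' := mem_Nb.1 (hC hu)
    have hv' := mem_Nb.1 (hC hv)
    exact (G.uniq _ _ _ _ hu' hv' rfl huv).2
  have hwA : w ∈ Nb G a := mem_Nb.2 (G.symm _ _ (mem_Nb.1 haw))
  obtain ⟨W, hWmem, hWmax⟩ := Finset.exists_max_image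
    ((Nb G a).powerset.filter (fun W => s * W.card ≤ (Cl G W).card)) Finset.card
    ⟨∅, by simp⟩
  simp only [Finset.mem_filter, Finset.mem_powerset] at hWmem hWmax
  obtain ⟨hWA, hWs⟩ := hWmem
  have hWne : 1 ≤ W.card := by
    have := hWmax {w} ⟨by simpa using hwA, ?_⟩
    · simpa using this
    · have : Nb G (y, c) ⊆ Cl G {w} := by
        intro z hz
        rw [mem_Cl]
        right
        exact ⟨w, by simp, by rw [hwb]; exact mem_Nb.1 hz⟩
      have := Finset.card_le_card this
      simp
      omega
  have h3 : ∀ u ∈ Nb G a, (Nb G u.bar \ Cl G W).card < s := by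
    intro u hu
    by_contra hcon
    push Not at hcon
    have huW : u ∉ W := by
      intro huW
      have : Nb G u.bar \ Cl G W = ∅ := by
        rw [Finset.sdiff_eq_empty_iff_subset]
        intro z hz
        exact mem_Cl.2 (Or.inr ⟨u, huW, mem_Nb.1 hz⟩)
      rw [this] at hcon
      simp at hcon
      omega
    have hsub : (Nb G u.bar \ Cl G W) ∪ Cl G W ⊆ Cl G (insert u W) := by
      intro z hz
      rw [mem_Cl]
      rw [Finset.mem_union, Finset.mem_sdiff] at hz
      rcases hz with ⟨hz, _⟩ | hz
      · exact Or.inr ⟨u, by simp, mem_Nb.1 hz⟩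
      · rcases mem_Cl.1 hz with h | ⟨x, hx, h⟩
        · exact Or.inl (by simp [h])
        · exact Or.inr ⟨x, by simp [hx], h⟩
    have h5 := Finset.card_le_card hsub
    rw [Finset.card_union_of_disjoint Finset.sdiff_disjoint] at h5
    have h6 := hWmax (insert u W) ⟨?_, ?_⟩
    · rw [Finset.card_insert_of_notMem huW] at h6
      omega
    · intro z hz
      rcases Finset.mem_insert.1 hz with rfl | hz
      · exact hu
      · exact hWA hz
    · rw [Finset.card_insert_of_notMem huW, mul_add]
      omega
  have hvc := hcardA _ (hClA W hWA)
  have hvn : (vars (Cl G W)).card ≤ n := by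
    simpa using Finset.card_le_univ (vars (Cl G W))
  have hWK : W.card ≤ K := by
    by_contra hcon
    push Not at hcon
    have : (K + 1) * s ≤ s * W.card := by
      rw [mul_comm]
      exact Nat.mul_le_mul_left _ hcon
    omega
  have ha : a.1 ∉ vars (Cl G W) := by
    rw [mem_vars]
    rintro ⟨c, hc⟩
    exact G.ne _ _ (mem_Nb.1 (hClA W hWA hc)) rfl
  refine ⟨a.1, a.2, W, hWK, mem_T2 s W G a ha0 (hClA W hWA) h3 ?_⟩
  rw [Cond2, Cl_del ha]
  by_cases hbig : 2 * n < 5 * (vars (Cl G W)).card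
  · exact Or.inl hbig
  right
  refine ⟨?_, ?_⟩
  · rw [hvc]
    refine le_trans ?_ hWs
    exact Nat.le_mul_of_pos_right _ hWne
  · intro z hz hza
    obtain ⟨c, hc⟩ := hL' z W hWK hz (by omega)
    refine ⟨c, ?_⟩
    have hsub : Nb G (z, c) \ Cl G W ⊆ insert a (Nb (del a.1 G) (z, c) \ Cl G W) := by
      intro u hu
      rw [Finset.mem_sdiff, mem_Nb] at hu
      rw [Finset.mem_insert, Finset.mem_sdiff, mem_Nb]
      by_cases hua : u.1 = a.1
      · left
        rcases Lit.eq_or_eq_bar hua.symm with h | h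
        · exact h
        · exfalso
          have : (z, c) ∈ Nb G a.bar := mem_Nb.2 (G.symm _ _ (h ▸ hu.1))
          simp [ha0] at this
      · exact Or.inr ⟨⟨hu.1, hza, hua⟩, hu.2⟩
    have h7 := (Finset.card_le_card hsub).trans (Finset.card_insert_le _ _)
    omega

lemma prod_ite_card {n : ℕ} (S : Finset (Fin n)) (x y : ℝ) :
    ∏ i : Fin n, (if i ∈ S then x else y) = x ^ S.card * y ^ (n - S.card) := by
  rw [Finset.prod_ite]
  simp only [Finset.prod_const]
  congr 2
  · congr 1
    ext i; simp
  · have : Finset.univ.filter (fun i => i ∉ S) = Sᶜ := by ext i; simp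
    rw [this, Finset.card_compl, Fintype.card_fin]

lemma card_TL_le {n : ℕ} (s : ℕ) (hs : 1120 * s ≤ n) (W : Finset (Lit n)) (G : ClauseG n) :
    ((TL s W G).card : ℝ) ≤ 2 ^ n * (49 / 50) ^ n := by
  classical
  rw [TL]
  split_ifs with hc
  swap
  · simp only [Finset.card_empty, Nat.cast_zero]; positivity
  set V := vars (Cl G W) with hV
  set wt : Fin n → Finset (Bool × Bool) → ℝ :=
    fun y p => if y ∉ V ∧ p ≠ ∅ then 1 / 256 else 1 with hwt
  have hwt0 : ∀ y p, 0 ≤ wt y p := by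
    intro y p
    simp only [hwt]
    split_ifs <;> norm_num
  have hprod : ∀ f : Fin n → Finset (Bool × Bool), ∏ y, wt y (f y) =
      (1 / 256) ^ (Finset.univ.filter (fun y => y ∉ V ∧ f y ≠ ∅)).card := by
    intro f
    simp only [hwt]
    rw [Finset.prod_ite]
    simp
  have h1 : (((Fintype.piFinset (fun _ : Fin n => small)).filter
      (fun f => (Finset.univ.filter (fun y => y ∉ V ∧ f y ≠ ∅)).card ≤ 2 * s)).card : ℝ) *
      (1 / 256) ^ (2 * s) ≤ ∑ f ∈ Fintype.piFinset (fun _ : Fin n => small), ∏ y, wt y (f y) := by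
    rw [← nsmul_eq_mul, ← Finset.sum_const]
    refine le_trans (Finset.sum_le_sum ?_) (Finset.sum_le_sum_of_subset_of_nonneg
      (Finset.filter_subset _ _) ?_)
    · intro f hf
      rw [hprod]
      rw [Finset.mem_filter] at hf
      exact pow_le_pow_of_le_one (by norm_num) (by norm_num) hf.2
    · intro f _ _
      exact Finset.prod_nonneg (fun y _ => hwt0 _ _)
  rw [← Finset.prod_univ_sum (fun _ : Fin n => small) wt] at h1
  have h2 : ∀ y : Fin n, ∑ p ∈ small, wt y p = if y ∈ V then 5 else 65 / 64 := by
    intro y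
    simp only [hwt]
    by_cases hy : y ∈ V
    · simp [hy, card_small]
    · have hsm : small = insert ∅ (small.erase ∅) := by decide
      have hsc : (small.erase ∅).card = 4 := by decide
      rw [hsm, Finset.sum_insert (by simp)]
      rw [Finset.sum_congr rfl (g := fun _ => (1 / 256 : ℝ))]
      · rw [Finset.sum_const, hsc]
        simp [hy]
        norm_num
      · intro p hp
        have := (Finset.mem_erase.1 hp).1
        simp [hy, this]
  rw [Finset.prod_congr rfl (fun y _ => h2 y), prod_ite_card] at h1
  have h5 : (5 : ℝ) ^ V.card ≤ (1.904) ^ n := by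
    have : ((5 : ℝ) ^ V.card) ^ 5 ≤ ((1.904) ^ n) ^ 5 := by
      calc ((5 : ℝ) ^ V.card) ^ 5 = 5 ^ (5 * V.card) := by rw [← pow_mul, mul_comm]
        _ ≤ 5 ^ (2 * n) := pow_le_pow_right₀ (by norm_num) hc
        _ = (25 : ℝ) ^ n := by rw [pow_mul]; norm_num
        _ ≤ ((1.904) ^ 5) ^ n := pow_le_pow_left₀ (by norm_num) (by norm_num) n
        _ = _ := by rw [← pow_mul, ← pow_mul, mul_comm]
    exact (pow_le_pow_iff_left₀ (by positivity) (by positivity) (by norm_num)).1 this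
  have h6 : (65 / 64 : ℝ) ^ (n - V.card) ≤ (65 / 64) ^ n :=
    pow_le_pow_right₀ (by norm_num) (Nat.sub_le _ _)
  have h7 : (256 : ℝ) ^ (2 * s) ≤ (1.01) ^ n := by
    calc (256 : ℝ) ^ (2 * s) = ((2 : ℝ) ^ 16) ^ s := by rw [pow_mul]; norm_num
      _ ≤ (((1.01 : ℝ) ^ 70) ^ 16) ^ s := by
          apply pow_le_pow_left₀ (by positivity)
          apply pow_le_pow_left₀ (by positivity)
          norm_num
      _ = (1.01) ^ (1120 * s) := by
          rw [← pow_mul, ← pow_mul]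
          congr 1
          omega
      _ ≤ _ := pow_le_pow_right₀ (by norm_num) hs
  set c : ℝ := (((Fintype.piFinset (fun _ : Fin n => small)).filter
      (fun f => (Finset.univ.filter (fun y => y ∉ V ∧ f y ≠ ∅)).card ≤ 2 * s)).card : ℝ)
  calc c = (c * (1 / 256) ^ (2 * s)) * 256 ^ (2 * s) := by
        rw [mul_assoc, ← mul_pow]; norm_num
    _ ≤ ((1.904) ^ n * (65 / 64) ^ n) * (1.01) ^ n := by
        apply mul_le_mul (h1.trans _) h7 (by positivity) (by positivity)
        exact mul_le_mul h5 h6 (by positivity) (by positivity)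
    _ = (1.904 * (65 / 64) * 1.01) ^ n := by rw [mul_pow, mul_pow]
    _ ≤ (2 * (49 / 50)) ^ n := pow_le_pow_left₀ (by norm_num) (by norm_num) n
    _ = _ := by rw [mul_pow]

lemma card_T2_le {n : ℕ} (s : ℕ) (hs : s ≤ n) (a : Fin n) (b : Bool) (W : Finset (Lit n))
    (G : ClauseG n) :
    ((T2 s a b W G).card : ℝ) ≤ 2 ^ n * ((49 / 50) ^ n + (1 / 2) ^ s) := by
  classical
  rw [T2]
  split_ifs with hc
  swap
  · simp only [Finset.card_empty, Nat.cast_zero]; positivity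
  rw [Fintype.card_piFinset]
  push_cast
  set V := vars (Cl G W) with hV
  have hVn : V.card ≤ n := by simpa using Finset.card_le_univ V
  rw [Cond2, ← hV] at hc
  rcases hc with hc | ⟨hc1, hc2⟩
  · have h1 : ∀ y, ((t2 s a b W G y).card : ℝ) ≤ if y ∈ V then 1 else 3 := by
      intro y
      rw [t2]
      split_ifs
      · simp
      · simp
      · simp
      · simp
      · have : ((Finset.univ.filter (fun c : Bool => (Nb G (y, !c) \ Cl G W).card < s)).image
          (fun c => ({(b, c)} : Finset (Bool × Bool)))).card ≤ 2 :=
          Finset.card_image_le.trans (Finset.card_le_univ _)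
        have h2 := Finset.card_union_le ({∅} : Finset (Finset (Bool × Bool)))
          ((Finset.univ.filter (fun c : Bool => (Nb G (y, !c) \ Cl G W).card < s)).image
          (fun c => ({(b, c)} : Finset (Bool × Bool))))
        rw [Finset.card_singleton] at h2
        have h3 := h2.trans (Nat.add_le_add_left this 1)
        exact_mod_cast h3
    have h2 := Finset.prod_le_prod (s := Finset.univ)
      (fun y _ => Nat.cast_nonneg (α := ℝ) (t2 s a b W G y).card) (fun y _ => h1 y)
    rw [prod_ite_card, one_pow, one_mul] at h2
    refine h2.trans ?_
    have : ((3 : ℝ) ^ (n - V.card)) ^ 5 ≤ ((1.94) ^ n) ^ 5 := by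
      calc ((3 : ℝ) ^ (n - V.card)) ^ 5 = 3 ^ (5 * (n - V.card)) := by rw [← pow_mul, mul_comm]
        _ ≤ 3 ^ (3 * n) := pow_le_pow_right₀ (by norm_num) (by omega)
        _ = (27 : ℝ) ^ n := by rw [pow_mul]; norm_num
        _ ≤ ((1.94) ^ 5) ^ n := pow_le_pow_left₀ (by norm_num) (by norm_num) n
        _ = _ := by rw [← pow_mul, ← pow_mul, mul_comm]
    have h3 := (pow_le_pow_iff_left₀ (by positivity) (by positivity) (by norm_num)).1 this
    have h4 : (1.94 : ℝ) ^ n ≤ 2 ^ n * (49 / 50) ^ n := by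
      rw [← mul_pow]
      exact pow_le_pow_left₀ (by norm_num) (by norm_num) n
    have h5 : (0 : ℝ) ≤ 2 ^ n * (1 / 2) ^ s := by positivity
    linarith
  · have h1 : ∀ y, ((t2 s a b W G y).card : ℝ) ≤ if y ∈ V then 1 else 2 := by
      intro y
      rw [t2]
      split_ifs with e1 e2 e3
      · simp
      · simp
      · simp
      · simp
      · obtain ⟨c, hcc⟩ := hc2 y (by assumption) e1
        have : ((Finset.univ.filter (fun c : Bool => (Nb G (y, !c) \ Cl G W).card < s)).image
          (fun c => ({(b, c)} : Finset (Bool × Bool)))).card ≤ 1 := by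
          refine Finset.card_image_le.trans ?_
          rw [Finset.card_le_one]
          intro x hx z hz
          simp only [Finset.mem_filter, Finset.mem_univ, true_and] at hx hz
          have hx' : (!x) ≠ c := by rintro h; rw [h] at hx; omega
          have hz' : (!z) ≠ c := by rintro h; rw [h] at hz; omega
          revert hx' hz'
          cases x <;> cases z <;> cases c <;> simp
        have h2 := Finset.card_union_le ({∅} : Finset (Finset (Bool × Bool)))
          ((Finset.univ.filter (fun c : Bool => (Nb G (y, !c) \ Cl G W).card < s)).image
          (fun c => ({(b, c)} : Finset (Bool × Bool))))
        rw [Finset.card_singleton] at h2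
        have h3 := h2.trans (Nat.add_le_add_left this 1)
        exact_mod_cast h3
    have h2 := Finset.prod_le_prod (s := Finset.univ)
      (fun y _ => Nat.cast_nonneg (α := ℝ) (t2 s a b W G y).card) (fun y _ => h1 y)
    rw [prod_ite_card, one_pow, one_mul] at h2
    refine h2.trans ?_
    have h3 : (2 : ℝ) ^ (n - V.card) ≤ 2 ^ (n - s) :=
      pow_le_pow_right₀ (by norm_num) (by omega)
    have h4 : (2 : ℝ) ^ (n - s) = 2 ^ n * (1 / 2) ^ s := by
      have : (2 : ℝ) ^ n = 2 ^ (n - s) * 2 ^ s := by rw [← pow_add]; congr 1; omega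
      rw [this, mul_assoc, ← mul_pow]
      norm_num
    have h5 : (0 : ℝ) ≤ 2 ^ n * (49 / 50) ^ n := by positivity
    linarith

open Classical in
lemma card_smallsets (α : Type) [Fintype α] (K : ℕ) :
    Fintype.card {W : Finset α // W.card ≤ K} ≤ (Fintype.card α + 1) ^ K := by
  have : Fintype.card (Fin K → Option α) = (Fintype.card α + 1) ^ K := by simp
  rw [← this]
  apply Fintype.card_le_of_injective
    (fun W : {W : Finset α // W.card ≤ K} => fun i : Fin K => W.1.toList[i.1]?)
  intro W W' h
  have key : ∀ W : {W : Finset α // W.card ≤ K}, ∀ x,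
      x ∈ W.1 ↔ ∃ i : Fin K, W.1.toList[i.1]? = some x := by
    intro W x
    rw [← Finset.mem_toList, List.mem_iff_getElem?]
    constructor
    · rintro ⟨i, hi⟩
      have h1 : i < W.1.toList.length := (List.getElem?_eq_some_iff.1 hi).1
      rw [Finset.length_toList] at h1
      exact ⟨⟨i, lt_of_lt_of_le h1 W.2⟩, hi⟩
    · rintro ⟨i, hi⟩
      exact ⟨i, hi⟩
  apply Subtype.ext
  ext x
  rw [key, key]
  constructor
  · rintro ⟨i, hi⟩
    exact ⟨i, (congrFun h i).symm.trans hi⟩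
  · rintro ⟨i, hi⟩
    exact ⟨i, (congrFun h i).trans hi⟩

lemma tri (n : ℕ) : n * (n + 1) / 2 = n + n.choose 2 := by
  rw [Nat.choose_two_right]
  rcases n with _ | m
  · rfl
  · simp only [Nat.add_sub_cancel]
    have : (m + 1) * (m + 1 + 1) = (m + 1) * m + 2 * (m + 1) := by ring
    rw [this, Nat.add_mul_div_left _ _ (by norm_num)]
    ring

instance (n : ℕ) : Fintype (SimpleGraph (Fin n)) := Fintype.ofFinite _

lemma card_graph (n : ℕ) : Nat.card (SimpleGraph (Fin n)) = 2 ^ (n.choose 2) := by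
  classical
  have e : SimpleGraph (Fin n) ≃ Set {e : Sym2 (Fin n) // ¬ e.IsDiag} :=
    { toFun := fun H => {e | e.1 ∈ H.edgeSet}
      invFun := fun S => SimpleGraph.fromEdgeSet (Subtype.val '' S)
      left_inv := by
        intro H
        ext u v
        simp only [SimpleGraph.fromEdgeSet_adj]
        constructor
        · rintro ⟨⟨e, he, h⟩, _⟩
          have : e.1 ∈ H.edgeSet := he
          rw [h] at this
          exact this
        · intro h
          exact ⟨⟨⟨s(u, v), by simpa using h.ne⟩, h, rfl⟩, h.ne⟩
      right_inv := by
        intro S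
        ext ⟨e, he⟩
        simp only [SimpleGraph.edgeSet_fromEdgeSet]
        constructor
        · rintro ⟨⟨e', h, rfl⟩, _⟩
          exact h
        · intro h
          exact ⟨⟨_, h, rfl⟩, he⟩ }
  rw [Nat.card_congr e, Nat.card_eq_fintype_card, Fintype.card_set, Sym2.card_subtype_not_diag,
    Fintype.card_fin]

open Classical in
lemma card_unate_le (n : ℕ) :
    (Finset.univ.filter (fun G : ClauseG n => Unate G)).card ≤ 2 ^ (n * (n + 1) / 2) := by
  have hc : Fintype.card ((Fin n → Bool) × SimpleGraph (Fin n)) = 2 ^ (n * (n + 1) / 2) := by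
    rw [Fintype.card_prod, ← Nat.card_eq_fintype_card (α := SimpleGraph (Fin n)), card_graph, tri,
      pow_add]
    simp
  rw [← hc, ← Fintype.card_subtype]
  let sg : {G : ClauseG n // Unate G} → Fin n → Bool := fun G y => !(Classical.choose (G.2 y))
  have hsg : ∀ (G : {G : ClauseG n // Unate G}) u v, G.1.E u v → u.2 = sg G u.1 := by
    rintro G ⟨y, b⟩ v h
    have := Classical.choose_spec (G.2 y)
    by_contra hne
    have : b = Classical.choose (G.2 y) := by
      simp only [sg] at hne
      revert hne
      cases b <;> cases Classical.choose (G.2 y) <;> simp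
    have h3 := Classical.choose_spec (G.2 y) v
    rw [← this] at h3
    exact h3 h
  have hE : ∀ (G : {G : ClauseG n // Unate G}) u v, G.1.E u v ↔
      (u.2 = sg G u.1 ∧ v.2 = sg G v.1 ∧ ∃ b c, G.1.E (u.1, b) (v.1, c)) := by
    intro G u v
    constructor
    · intro h
      exact ⟨hsg G u v h, hsg G v u (G.1.symm _ _ h), u.2, v.2, h⟩
    · rintro ⟨h1, h2, b, c, h⟩
      have h3 := hsg G _ _ h
      have h4 := hsg G _ _ (G.1.symm _ _ h)
      simp only at h3 h4
      rw [← h1] at h3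
      rw [← h2] at h4
      subst h3 h4
      exact h
  apply Fintype.card_le_of_injective (fun G => (sg G,
    (⟨fun y z => ∃ b c, G.1.E (y, b) (z, c), ⟨fun y z ⟨b, c, h⟩ => ⟨c, b, G.1.symm _ _ h⟩⟩,
      ⟨fun y ⟨b, c, h⟩ => G.1.ne _ _ h rfl⟩⟩ : SimpleGraph (Fin n))))
  intro G H h
  simp only [Prod.mk.injEq, SimpleGraph.mk.injEq] at h
  apply Subtype.ext
  apply ClauseG.ext'
  intro u v
  rw [hE, hE, h.1]
  have := congrFun (congrFun h.2 u.1) v.1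
  rw [this]

open Classical in
lemma upper_step (n : ℕ) (hn : 1120 ≤ n + 1) :
    (Fintype.card (ClauseG (n + 1)) : ℝ) ≤ 2 ^ ((n + 1) * (n + 1 + 1) / 2) +
      Fintype.card (ClauseG n) * 2 ^ (n + 1) * ((n + 1 : ℕ) * (2 * (n + 1 : ℕ) + 1) ^ 2240 *
        (3 * (49 / 50) ^ (n + 1) + 2 * (1 / 2) ^ ((n + 1) / 1120))) := by
  set N := n + 1 with hN
  set s := N / 1120 with hs
  have hs1 : 1 ≤ s := by omega
  have hsN : 1120 * s ≤ N := by omega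
  set K := 2240 with hK
  have hKs : N < (K + 1) * s := by omega
  set SL := Finset.univ.filter (fun G : ClauseG N =>
    ∃ a W, W.card ≤ K ∧ att a G ∈ TL s W (del a G)) with hSL
  set S2 := Finset.univ.filter (fun G : ClauseG N =>
    ∃ a b W, W.card ≤ K ∧ att a G ∈ T2 s a b W (del a G)) with hS2
  set SU := Finset.univ.filter (fun G : ClauseG N => Unate G) with hSU
  have hcov : (Finset.univ : Finset (ClauseG N)) ⊆ SU ∪ (SL ∪ S2) := by
    intro G _
    simp only [hSU, hSL, hS2, Finset.mem_union, Finset.mem_filter, Finset.mem_univ, true_and]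
    exact structure_thm G s K hs1 hKs
  have h1 := (Finset.card_le_card hcov).trans (Finset.card_union_le _ _)
  have h2 := h1.trans (Nat.add_le_add_left (Finset.card_union_le _ _) _)
  rw [Finset.card_univ] at h2
  have hU : (SU.card : ℝ) ≤ 2 ^ (N * (N + 1) / 2) := by exact_mod_cast card_unate_le N
  have hW : (Fintype.card {W : Finset (Lit N) // W.card ≤ K} : ℝ) ≤ (2 * (N : ℝ) + 1) ^ K := by
    have := card_smallsets (Lit N) K
    have h3 : Fintype.card (Lit N) = 2 * N := by simp [mul_comm]
    rw [h3] at this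
    exact_mod_cast this
  have hLc := count_many (I := Fin N × {W : Finset (Lit N) // W.card ≤ K}) (fun i => i.1) SL
    (fun i G => TL s i.2.1 G) _ (by
      intro G hG
      simp only [hSL, Finset.mem_filter, Finset.mem_univ, true_and] at hG
      obtain ⟨a, W, h, h'⟩ := hG
      exact ⟨(a, ⟨W, h⟩), h'⟩) (fun i G => card_TL_le s hsN i.2.1 G)
  have h2c := count_many (I := (Fin N × Bool) × {W : Finset (Lit N) // W.card ≤ K})
    (fun i => i.1.1) S2
    (fun i G => T2 s i.1.1 i.1.2 i.2.1 G) _ (by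
      intro G hG
      simp only [hS2, Finset.mem_filter, Finset.mem_univ, true_and] at hG
      obtain ⟨a, b, W, h, h'⟩ := hG
      exact ⟨((a, b), ⟨W, h⟩), h'⟩) (fun i G => card_T2_le s (by omega) i.1.1 i.1.2 i.2.1 G)
  rw [Fintype.card_prod, Fintype.card_fin] at hLc
  rw [Fintype.card_prod, Fintype.card_prod, Fintype.card_fin, Fintype.card_bool] at h2c
  have h2' : (Fintype.card (ClauseG N) : ℝ) ≤ SU.card + (SL.card + S2.card) := by exact_mod_cast h2
  push_cast at hLc h2c
  set w : ℝ := (Fintype.card {W : Finset (Lit N) // W.card ≤ K} : ℝ)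
  set F : ℝ := (Fintype.card (ClauseG n) : ℝ)
  have hF : 0 ≤ F := Nat.cast_nonneg _
  have hLc' : (SL.card : ℝ) ≤ N * (2 * (N : ℝ) + 1) ^ K * (F * (2 ^ N * (49 / 50) ^ N)) := by
    refine hLc.trans ?_
    gcongr
  have h2c' : (S2.card : ℝ) ≤ N * 2 * (2 * (N : ℝ) + 1) ^ K *
      (F * (2 ^ N * ((49 / 50) ^ N + (1 / 2) ^ s))) := by
    refine h2c.trans ?_
    gcongr
  generalize (2 * (N : ℝ) + 1) ^ K = Z at *
  generalize (49 / 50 : ℝ) ^ N = X at *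
  generalize (1 / 2 : ℝ) ^ s = Y at *
  generalize (2 : ℝ) ^ N = Q at *
  calc _ ≤ _ := h2'
    _ ≤ _ := add_le_add hU (add_le_add hLc' h2c')
    _ = _ := by ring

def rho : ℝ := 1 - 1 / 2240

lemma half_pow_le (N : ℕ) : (1 / 2 : ℝ) ^ (N / 1120) ≤ 2 * rho ^ N := by
  have h1 : (1 / 2 : ℝ) ≤ rho ^ 1120 := by
    have := one_add_mul_le_pow (a := (-(1 / 2240) : ℝ)) (by norm_num) 1120
    have e : (1 : ℝ) + -(1 / 2240) = rho := by unfold rho; ring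
    rw [e] at this
    refine le_trans ?_ this
    norm_num
  have h2 : (1 / 2 : ℝ) ^ (N / 1120 + 1) ≤ rho ^ N := by
    calc (1 / 2 : ℝ) ^ (N / 1120 + 1) ≤ (rho ^ 1120) ^ (N / 1120 + 1) :=
          pow_le_pow_left₀ (by norm_num) h1 _
      _ = rho ^ (1120 * (N / 1120 + 1)) := by rw [← pow_mul]
      _ ≤ rho ^ N := pow_le_pow_of_le_one (by unfold rho; norm_num) (by unfold rho; norm_num)
          (by omega)
  rw [pow_succ] at h2
  linarith

def ratio (n : ℕ) : ℝ := (Fintype.card (ClauseG n) : ℝ) / 2 ^ (n * (n + 1) / 2)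

def epsn (K : ℕ) (N : ℕ) : ℝ := 7 * 3 ^ K * ((N : ℝ) ^ (K + 1) * rho ^ N)

lemma tri_succ (n : ℕ) : (n + 1) * (n + 1 + 1) / 2 = n * (n + 1) / 2 + (n + 1) := by
  have : (n + 1) * (n + 1 + 1) = n * (n + 1) + 2 * (n + 1) := by ring
  rw [this, Nat.add_mul_div_left _ _ (by norm_num)]

lemma eps_bound (K N : ℕ) (hN : 1 ≤ N) : (N : ℝ) * (2 * (N : ℝ) + 1) ^ K *
        (3 * (49 / 50) ^ N + 2 * (1 / 2) ^ (N / 1120)) ≤ epsn K N := by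
  have hN' : (1 : ℝ) ≤ N := by exact_mod_cast hN
  have h1 : (2 * (N : ℝ) + 1) ^ K ≤ (3 * N) ^ K := by
    apply pow_le_pow_left₀ (by positivity)
    linarith
  have h2 : (49 / 50 : ℝ) ^ N ≤ rho ^ N := by
    apply pow_le_pow_left₀ (by norm_num)
    unfold rho
    norm_num
  have h3 := half_pow_le N
  have hr : 0 ≤ rho ^ N := by
    apply pow_nonneg
    unfold rho
    norm_num
  calc (N : ℝ) * (2 * (N : ℝ) + 1) ^ K * (3 * (49 / 50) ^ N + 2 * (1 / 2) ^ (N / 1120))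
      ≤ N * (3 * N) ^ K * (7 * rho ^ N) := by
        apply mul_le_mul _ (by linarith) (by positivity) (by positivity)
        apply mul_le_mul_of_nonneg_left h1 (by positivity)
    _ = _ := by
        unfold epsn
        rw [mul_pow, pow_succ]
        ring

lemma ratio_step (n : ℕ) (hn : 1120 ≤ n + 1) :
    ratio (n + 1) ≤ 1 + epsn 2240 (n + 1) * ratio n := by
  have h := upper_step n hn
  have he := eps_bound 2240 (n + 1) (by omega)
  have h' : (Fintype.card (ClauseG (n + 1)) : ℝ) ≤ 2 ^ ((n + 1) * (n + 1 + 1) / 2) +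
      Fintype.card (ClauseG n) * 2 ^ (n + 1) * epsn 2240 (n + 1) := by
    refine h.trans ?_
    gcongr
  unfold ratio
  rw [tri_succ, pow_add] at *
  rw [div_le_iff₀ (by positivity)]
  refine h'.trans (le_of_eq ?_)
  field_simp

lemma eps_tendsto (K : ℕ) : Tendsto (epsn K) atTop (nhds 0) := by
  have h := tendsto_pow_const_mul_const_pow_of_lt_one (K + 1) (r := rho)
    (by unfold rho; norm_num) (by unfold rho; norm_num)
  have := h.const_mul (7 * (3 : ℝ) ^ K)
  rw [mul_zero] at this
  exact this

lemma ratio_nonneg (n : ℕ) : 0 ≤ ratio n := by unfold ratio; positivity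

lemma ratio_bdd : ∃ B, ∀ᶠ n in atTop, ratio n ≤ B := by
  have h1 : ∀ᶠ n in atTop, epsn 2240 n ≤ 1 / 2 :=
    (eps_tendsto 2240).eventually_le_const (by norm_num)
  obtain ⟨n0, hn0⟩ := eventually_atTop.1 h1
  refine ⟨max (ratio (n0 + 1120)) 2, eventually_atTop.2 ⟨n0 + 1120, ?_⟩⟩
  intro n hn
  induction n, hn using Nat.le_induction with
  | base => exact le_max_left _ _
  | succ n hn ih =>
    have h2 := ratio_step n (by omega)
    have h3 := hn0 (n + 1) (by omega)
    have h4 := mul_le_mul_of_nonneg_right h3 (ratio_nonneg n)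
    have h5 := le_max_right (ratio (n0 + 1120)) 2
    linarith

open Classical in
lemma card_isolated_le (n : ℕ) :
    (Finset.univ.filter (fun H : SimpleGraph (Fin (n + 1)) => ∃ v, ∀ u, ¬ H.Adj v u)).card ≤
      (n + 1) * 2 ^ (n.choose 2) := by
  have h3 : Finset.univ.filter (fun H : SimpleGraph (Fin (n + 1)) => ∃ v, ∀ u, ¬ H.Adj v u) ⊆
      Finset.univ.biUnion (fun v => Finset.univ.filter
        (fun H : SimpleGraph (Fin (n + 1)) => ∀ u, ¬ H.Adj v u)) := by
    intro G hG
    simpa using hG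
  refine (Finset.card_le_card h3).trans ?_
  refine (Finset.card_biUnion_le_card_mul _ _ (2 ^ (n.choose 2)) ?_).trans (by simp)
  intro v _
  rw [← card_graph, Nat.card_eq_fintype_card, ← Finset.card_univ]
  apply Finset.card_le_card_of_injOn (fun H => H.comap v.succAbove)
  · intro x _
    simp
  · intro G hG H hH h
    simp only [Finset.coe_filter, Finset.mem_univ, true_and, Set.mem_ofPred_eq] at hG hH
    ext x y
    by_cases hx : x = v
    · subst hx
      exact ⟨fun h => absurd h (hG _), fun h => absurd h (hH _)⟩
    by_cases hy : y = v
    · subst hy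
      exact ⟨fun h => absurd h.symm (hG _), fun h => absurd h.symm (hH _)⟩
    obtain ⟨i, rfl⟩ := Fin.exists_succAbove_eq hx
    obtain ⟨j, rfl⟩ := Fin.exists_succAbove_eq hy
    have h3 : (SimpleGraph.comap v.succAbove G).Adj i j ↔
      (SimpleGraph.comap v.succAbove H).Adj i j := by
      simp only at h
      rw [h]
    simpa using h3

def mkU {n : ℕ} (sg : Fin n → Bool) (H : SimpleGraph (Fin n)) : ClauseG n where
  E u v := H.Adj u.1 v.1 ∧ u.2 = sg u.1 ∧ v.2 = sg v.1
  symm _ _ h := ⟨h.1.symm, h.2.2, h.2.1⟩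
  ne _ _ h := h.1.ne
  uniq u v u' v' h h' e e' := by
    refine ⟨Prod.ext e ?_, Prod.ext e' ?_⟩
    · rw [h.2.1, h'.2.1, e]
    · rw [h.2.2, h'.2.2, e']
  trans u v w h h' := by
    exfalso
    have h1 := h.2.2
    have h2 := h'.2.1
    simp only [Lit.bar] at h2
    rw [h1] at h2
    simp at h2

open Classical in
lemma lower_step (n : ℕ) : (2 : ℝ) ^ ((n + 1) * (n + 1 + 1) / 2) -
    2 ^ (n + 1) * ((n + 1) * 2 ^ (n.choose 2)) ≤ Fintype.card (ClauseG (n + 1)) := by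
  set A := Finset.univ.filter (fun H : SimpleGraph (Fin (n + 1)) => ∃ v, ∀ u, ¬ H.Adj v u) with hA
  have h1 : ((Finset.univ : Finset (Fin (n + 1) → Bool)) ×ˢ Aᶜ).card ≤
      Fintype.card (ClauseG (n + 1)) := by
    rw [← Finset.card_univ (α := ClauseG (n + 1))]
    apply Finset.card_le_card_of_injOn (fun p => mkU p.1 p.2)
    · intro x _
      simp
    · rintro ⟨sg, H⟩ hH ⟨sg', H'⟩ hH' h
      simp only [hA, Finset.coe_product, Finset.coe_univ, Finset.coe_compl, Finset.coe_filter,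
        Finset.mem_univ, true_and, Set.mem_prod, Set.mem_univ, Set.mem_compl_iff,
        Set.mem_ofPred_eq, not_exists, not_forall, not_not] at hH hH'
      simp only at h
      have hE : ∀ u v, (mkU sg H).E u v ↔ (mkU sg' H').E u v := by
        intro u v
        rw [h]
      have e1 : sg = sg' := by
        funext y
        obtain ⟨z, hz⟩ := hH y
        exact ((hE (y, sg y) (z, sg z)).1 ⟨hz, rfl, rfl⟩).2.1
      subst e1
      have e2 : H = H' := by
        ext y z
        constructor
        · intro hz
          exact ((hE (y, sg y) (z, sg z)).1 ⟨hz, rfl, rfl⟩).1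
        · intro hz
          exact ((hE (y, sg y) (z, sg z)).2 ⟨hz, rfl, rfl⟩).1
      rw [e2]
  rw [Finset.card_product, Finset.card_univ] at h1
  have h2 : Fintype.card (Fin (n + 1) → Bool) = 2 ^ (n + 1) := by simp
  have h3 := Finset.card_add_card_compl A
  rw [← Nat.card_eq_fintype_card, card_graph] at h3
  rw [h2] at h1
  have h4 := card_isolated_le n
  rw [← hA] at h4
  have h1' : (2 : ℝ) ^ (n + 1) * Aᶜ.card ≤ Fintype.card (ClauseG (n + 1)) := by exact_mod_cast h1
  have h3' : (A.card : ℝ) + Aᶜ.card = 2 ^ ((n + 1).choose 2) := by exact_mod_cast h3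
  have h4' : (A.card : ℝ) ≤ (n + 1) * 2 ^ (n.choose 2) := by exact_mod_cast h4
  refine le_trans ?_ h1'
  rw [tri, pow_add, ← mul_sub]
  apply mul_le_mul_of_nonneg_left _ (by positivity)
  linarith

lemma ratio_lower (n : ℕ) : 1 - 2 * (((n + 1 : ℕ) : ℝ) ^ 1 * (1 / 2) ^ (n + 1)) ≤ ratio (n + 1) := by
  have h := lower_step n
  unfold ratio
  rw [le_div_iff₀ (by positivity)]
  refine le_trans (le_of_eq ?_) h
  have e : (n + 1).choose 2 = n + n.choose 2 := by
    rw [Nat.choose_succ_succ' n 1, Nat.choose_one_right]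
  have e2 : (1 / 2 : ℝ) ^ (n + 1) * 2 ^ (n + 1) = 1 := by
    rw [← mul_pow]; norm_num
  rw [tri, e, pow_add, pow_add]
  push_cast
  rw [sub_mul, one_mul, pow_one]
  congr 1
  calc _ = ((1 / 2 : ℝ) ^ (n + 1) * 2 ^ (n + 1)) * ((n + 1) * (2 ^ n * 2) * 2 ^ (n.choose 2)) := by
        ring
    _ = _ := by rw [e2, ← pow_succ]; ring

/-- `|𝓟(n)| = (1+o(1)) 2^{n(n+1)/2}`. -/
theorem litPoset_count :
    Tendsto (fun n : ℕ => (Nat.card (LitPoset n) : ℝ) / (2 : ℝ) ^ (n * (n + 1) / 2))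
      atTop (nhds 1) := by
  have hr : (fun n : ℕ => (Nat.card (LitPoset n) : ℝ) / (2 : ℝ) ^ (n * (n + 1) / 2)) = ratio := by
    funext n
    rw [Nat.card_congr (litEquiv n), Nat.card_eq_fintype_card]
    rfl
  rw [hr, ← tendsto_add_atTop_iff_nat 1]
  obtain ⟨B, hB⟩ := ratio_bdd
  have hlow : Tendsto (fun n : ℕ => 1 - 2 * (((n + 1 : ℕ) : ℝ) ^ 1 * (1 / 2) ^ (n + 1)))
      atTop (nhds 1) := by
    have h := tendsto_pow_const_mul_const_pow_of_lt_one 1 (r := (1 / 2 : ℝ))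
      (by norm_num) (by norm_num)
    have h2 := (h.comp (tendsto_add_atTop_nat 1)).const_mul 2
    have h3 := h2.const_sub 1
    simpa using h3
  have hup : Tendsto (fun n : ℕ => 1 + epsn 2240 (n + 1) * B) atTop (nhds 1) := by
    have h2 := (((eps_tendsto 2240).comp (tendsto_add_atTop_nat 1)).mul_const B).const_add 1
    rw [zero_mul, add_zero] at h2
    exact h2
  refine tendsto_of_tendsto_of_tendsto_of_le_of_le' hlow hup
    (Eventually.of_forall ratio_lower) ?_
  filter_upwards [hB, eventually_ge_atTop 1120] with n h1 h2
  refine (ratio_step n (by omega)).trans ?_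
  have : 0 ≤ epsn 2240 (n + 1) := by
    unfold epsn
    have : 0 ≤ rho := by unfold rho; norm_num
    positivity
  have := mul_le_mul_of_nonneg_left h1 this
  linarith
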